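/- Let A, B be positive integers, Q ∈ ℝ^{A×B} with ‖Q‖_F ≠ 0, t₀ > 0 and t ≥ 0. Let E ∈ ℝ^{A×B} be the all-ones matrix. Then the minimum of ⟨Q,X⟩_F + t₀‖X‖₁ over {X ∈ ℝ^{A×B} : ‖X‖_F² ≤ t², X ≥ 0} equals −t‖Π₊(−(Q + t₀E))‖_F, and if ‖Π₊(−(Q + t₀E))‖_F ≠ 0 the minimum is attained at X* = t·Π₊(−(Q + t₀E))/‖Π₊(−(Q + t₀E))‖_F. -/

import Mathlib

/-- Frobenius inner product of real matrices. -/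
noncomputable def fip {m n : ℕ} (X Y : Matrix (Fin m) (Fin n) ℝ) : ℝ :=
  ∑ i, ∑ j, X i j * Y i j

/-- Frobenius norm of a real matrix. -/
noncomputable def fnorm {m n : ℕ} (X : Matrix (Fin m) (Fin n) ℝ) : ℝ :=
  Real.sqrt (fip X X)

/-- Entrywise ℓ1 norm of a real matrix. -/
noncomputable def l1 {m n : ℕ} (X : Matrix (Fin m) (Fin n) ℝ) : ℝ :=
  ∑ i, ∑ j, |X i j|

/-- Entrywise positive part Π₊. -/
def pp {m n : ℕ} (Y : Matrix (Fin m) (Fin n) ℝ) : Matrix (Fin m) (Fin n) ℝ :=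
  fun i j => max (Y i j) 0

/-- The all-ones matrix. -/
def onesM (m n : ℕ) : Matrix (Fin m) (Fin n) ℝ := fun _ _ => 1

section Frobenius

variable {m n : ℕ}

lemma fip_self_nonneg (X : Matrix (Fin m) (Fin n) ℝ) : 0 ≤ fip X X :=
  Finset.sum_nonneg fun _ _ => Finset.sum_nonneg fun _ _ => mul_self_nonneg _

lemma fnorm_sq (X : Matrix (Fin m) (Fin n) ℝ) : fnorm X ^ 2 = fip X X :=
  Real.sq_sqrt (fip_self_nonneg X)

lemma fnorm_nonneg (X : Matrix (Fin m) (Fin n) ℝ) : 0 ≤ fnorm X :=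
  Real.sqrt_nonneg _

lemma fip_smul_right (c : ℝ) (X Y : Matrix (Fin m) (Fin n) ℝ) :
    fip X (c • Y) = c * fip X Y := by
  simp only [fip, Matrix.smul_apply, smul_eq_mul, Finset.mul_sum]
  exact Finset.sum_congr rfl fun _ _ => Finset.sum_congr rfl fun _ _ => by ring

lemma fnorm_smul_sq (c : ℝ) (X : Matrix (Fin m) (Fin n) ℝ) :
    fnorm (c • X) ^ 2 = c ^ 2 * fnorm X ^ 2 := by
  simp only [fnorm_sq, fip, Matrix.smul_apply, smul_eq_mul, Finset.mul_sum]
  exact Finset.sum_congr rfl fun _ _ => Finset.sum_congr rfl fun _ _ => by ring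

/-- The Cauchy–Schwarz inequality for the Frobenius inner product. -/
lemma fip_le_fnorm_mul_fnorm (X Y : Matrix (Fin m) (Fin n) ℝ) :
    fip X Y ≤ fnorm X * fnorm Y := by
  simpa only [fnorm, fip, ← Fintype.sum_prod_type', ← pow_two] using
    Real.sum_mul_le_sqrt_mul_sqrt Finset.univ
      (fun p : Fin m × Fin n => X p.1 p.2) (fun p => Y p.1 p.2)

lemma pp_nonneg (Y : Matrix (Fin m) (Fin n) ℝ) (i : Fin m) (j : Fin n) : 0 ≤ pp Y i j :=
  le_max_right _ _

lemma fip_le_fip_pp (Y : Matrix (Fin m) (Fin n) ℝ) {X : Matrix (Fin m) (Fin n) ℝ}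
    (hX : ∀ i j, 0 ≤ X i j) : fip Y X ≤ fip (pp Y) X :=
  Finset.sum_le_sum fun i _ => Finset.sum_le_sum fun j _ =>
    mul_le_mul_of_nonneg_right (le_max_left _ _) (hX i j)

lemma fip_pp_right (Y : Matrix (Fin m) (Fin n) ℝ) : fip Y (pp Y) = fnorm (pp Y) ^ 2 := by
  rw [fnorm_sq]
  refine Finset.sum_congr rfl fun i _ => Finset.sum_congr rfl fun j _ => ?_
  rcases le_total (Y i j) 0 with h | h <;> simp [pp, h]

lemma fip_add_mul_l1 (Q : Matrix (Fin m) (Fin n) ℝ) (c : ℝ) {X : Matrix (Fin m) (Fin n) ℝ}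
    (hX : ∀ i j, 0 ≤ X i j) :
    fip Q X + c * l1 X = -fip (-(Q + c • onesM m n)) X := by
  simp only [fip, l1, Finset.mul_sum, ← Finset.sum_add_distrib, ← Finset.sum_neg_distrib]
  refine Finset.sum_congr rfl fun i _ => Finset.sum_congr rfl fun j _ => ?_
  simp only [abs_of_nonneg (hX i j), Matrix.neg_apply, Matrix.add_apply, Matrix.smul_apply,
    onesM, smul_eq_mul]
  ring

end Frobenius

/-- minimum of ⟨Q,X⟩_F + t₀‖X‖₁ over the nonnegative part of the Frobenius
ball of radius t equals −t‖Π₊(−(Q+t₀E))‖_F, attained at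
X* = t·Π₊(−(Q+t₀E))/‖Π₊(−(Q+t₀E))‖_F when that norm is nonzero. -/
theorem stmt5 (A B : ℕ) (hA : 0 < A) (hB : 0 < B)
    (Q : Matrix (Fin A) (Fin B) ℝ) (hQ : fnorm Q ≠ 0) (t₀ t : ℝ)
    (ht₀ : 0 < t₀) (ht : 0 ≤ t) :
    IsLeast ((fun X : Matrix (Fin A) (Fin B) ℝ => fip Q X + t₀ * l1 X) ''
        {X | fnorm X ^ 2 ≤ t ^ 2 ∧ ∀ i j, 0 ≤ X i j})
      (-(t * fnorm (pp (-(Q + t₀ • onesM A B))))) ∧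
    (fnorm (pp (-(Q + t₀ • onesM A B))) ≠ 0 →
      fnorm ((t / fnorm (pp (-(Q + t₀ • onesM A B)))) • pp (-(Q + t₀ • onesM A B))) ^ 2
          ≤ t ^ 2 ∧
      (∀ i j, 0 ≤ ((t / fnorm (pp (-(Q + t₀ • onesM A B)))) •
          pp (-(Q + t₀ • onesM A B))) i j) ∧
      fip Q ((t / fnorm (pp (-(Q + t₀ • onesM A B)))) • pp (-(Q + t₀ • onesM A B))) +
          t₀ * l1 ((t / fnorm (pp (-(Q + t₀ • onesM A B)))) • pp (-(Q + t₀ • onesM A B))) =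
        -(t * fnorm (pp (-(Q + t₀ • onesM A B))))) := by
  set M := -(Q + t₀ • onesM A B) with hM
  have hnonneg : ∀ i j, 0 ≤ ((t / fnorm (pp M)) • pp M) i j := fun i j =>
    mul_nonneg (div_nonneg ht (fnorm_nonneg _)) (pp_nonneg M i j)
  have hball : fnorm ((t / fnorm (pp M)) • pp M) ^ 2 ≤ t ^ 2 := by
    rw [fnorm_smul_sq]
    rcases eq_or_ne (fnorm (pp M)) 0 with h | h
    · simp [h, sq_nonneg]
    · exact le_of_eq (by field_simp)
  have hval : fip Q ((t / fnorm (pp M)) • pp M) + t₀ * l1 ((t / fnorm (pp M)) • pp M) =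
      -(t * fnorm (pp M)) := by
    rw [fip_add_mul_l1 Q t₀ hnonneg, ← hM, fip_smul_right, fip_pp_right]
    rcases eq_or_ne (fnorm (pp M)) 0 with h | h
    · simp [h]
    · field_simp
  refine ⟨⟨⟨_, ⟨hball, hnonneg⟩, hval⟩, ?_⟩, fun _ => ⟨hball, hnonneg, hval⟩⟩
  rintro _ ⟨X, ⟨hXt, hX⟩, rfl⟩
  simp only [fip_add_mul_l1 Q t₀ hX, ← hM]
  have hXle : fnorm X ≤ t := (sq_le_sq₀ (fnorm_nonneg X) ht).1 hXt
  refine neg_le_neg ?_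
  calc fip M X ≤ fip (pp M) X := fip_le_fip_pp M hX
    _ ≤ fnorm (pp M) * fnorm X := fip_le_fnorm_mul_fnorm _ _
    _ ≤ fnorm (pp M) * t := mul_le_mul_of_nonneg_left hXle (fnorm_nonneg _)
    _ = t * fnorm (pp M) := mul_comm _ _
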